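/- Let n ≥ 2 and let Ω ⊂ ℝⁿ be a bounded uniform domain. Then Ω is a local Sobolev–Poincaré imbedding domain of order n (local Trudinger inequality): there exist constants C ≥ 1, λ ≥ 1 and A > 0 such that for every locally Lipschitz function u : Ω → ℝ, every x ∈ Ω and every 0 < r < diam(Ω) with 0 < ∫_{B(x,λr)∩Ω} |∇u(y)|ⁿ dy < ∞, one has inf_{c∈ℝ} ∫_{B(x,r)∩Ω} exp( (A |u(y) − c| / (∫_{B(x,λr)∩Ω} |∇u(z)|ⁿ dz)^{1/n})^{n/(n−1)} ) dy ≤ C |B(x,r)|. -/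

import Mathlib

open Set Metric MeasureTheory ENNReal NNReal

noncomputable section

/-- Euclidean space `ℝⁿ`. -/
abbrev Euc (n : ℕ) : Type := EuclideanSpace ℝ (Fin n)

/-- `u` is locally Lipschitz on the set `Ω`. -/
def LocallyLipschitzOnSet {n : ℕ} (u : Euc n → ℝ) (Ω : Set (Euc n)) : Prop :=
  ∀ x ∈ Ω, ∃ K : ℝ≥0, ∃ s ∈ nhdsWithin x Ω, LipschitzOnWith K u s

/-- `x` and `y` are joined by a (continuous) curve lying in `S`. -/
def JoinedByCurveIn {n : ℕ} (S : Set (Euc n)) (x y : Euc n) : Prop :=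
  ∃ γ : ℝ → Euc n, ContinuousOn γ (Icc 0 1) ∧ γ 0 = x ∧ γ 1 = y ∧ MapsTo γ (Icc 0 1) S

/-- `γ` is parametrized by arclength on `[0, L]`. -/
def ArclengthOn {n : ℕ} (γ : ℝ → Euc n) (L : ℝ) : Prop :=
  ∀ s t : ℝ, 0 ≤ s → s ≤ t → t ≤ L → eVariationOn γ (Icc s t) = ENNReal.ofReal (t - s)

/-- `Ω` is an `ε₀`-uniform domain. -/
def IsUniformWith {n : ℕ} (Ω : Set (Euc n)) (ε₀ : ℝ) : Prop :=
  ∀ x ∈ Ω, ∀ y ∈ Ω, ∃ γ : ℝ → Euc n,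
    ContinuousOn γ (Icc 0 1) ∧ γ 0 = x ∧ γ 1 = y ∧ MapsTo γ (Icc 0 1) Ω ∧
    eVariationOn γ (Icc 0 1) ≤ ENNReal.ofReal (dist x y / ε₀) ∧
    ∀ t ∈ Icc (0:ℝ) 1,
      ε₀ * (dist x (γ t) * dist y (γ t)) / dist x y ≤ infDist (γ t) (frontier Ω)

/-- `Ω` is a uniform domain. -/
def IsUniformDomain {n : ℕ} (Ω : Set (Euc n)) : Prop :=
  ∃ ε₀ : ℝ, 0 < ε₀ ∧ ε₀ ≤ 1 ∧ IsUniformWith Ω ε₀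

/-- `Ω` is an `α`-cigar domain: any two points can be joined by a rectifiable
(arclength-parametrized) curve in `Ω` along which
`∫_γ dist(z, ∂Ω)^(α-1) |dz| ≤ C |x - y|^α`. -/
def IsCigarDomain {n : ℕ} (Ω : Set (Euc n)) (α : ℝ) : Prop :=
  ∃ C : ℝ, 0 < C ∧ ∀ x ∈ Ω, ∀ y ∈ Ω, ∃ L : ℝ, 0 ≤ L ∧ ∃ γ : ℝ → Euc n,
    γ 0 = x ∧ γ L = y ∧ MapsTo γ (Icc 0 L) Ω ∧ ArclengthOn γ L ∧
    (∫⁻ t in Icc (0:ℝ) L, ENNReal.ofReal (infDist (γ t) (frontier Ω) ^ (α - 1)) ∂volume)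
      ≤ ENNReal.ofReal (C * dist x y ^ α)

/-- `Ω` is a `c₀`-John domain. -/
def IsJohnDomain {n : ℕ} (Ω : Set (Euc n)) (c₀ : ℝ) : Prop :=
  ∃ x₀ ∈ Ω, ∀ x ∈ Ω, ∃ l : ℝ, 0 ≤ l ∧ ∃ γ : ℝ → Euc n,
    γ 0 = x ∧ γ l = x₀ ∧ MapsTo γ (Icc 0 l) Ω ∧ ArclengthOn γ l ∧
    ∀ t ∈ Icc (0:ℝ) l, c₀ * t ≤ infDist (γ t) (frontier Ω)

/-- `Ω` has the `C`-slice property with respect to `x₀`. -/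
def HasSliceProperty {n : ℕ} (Ω : Set (Euc n)) (C : ℝ) (x₀ : Euc n) : Prop :=
  ∀ x ∈ Ω, ∃ γ : ℝ → Euc n,
    ContinuousOn γ (Icc 0 1) ∧ γ 0 = x₀ ∧ γ 1 = x ∧ MapsTo γ (Icc 0 1) Ω ∧
    ∃ j : ℕ, ∃ U : Fin (j + 1) → Set (Euc n),
      (∀ i, IsOpen (U i) ∧ U i ⊆ Ω) ∧
      (Pairwise fun i₁ i₂ => Disjoint (U i₁) (U i₂)) ∧
      -- (1)
      x₀ ∈ U 0 ∧ x ∈ U (Fin.last j) ∧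
      (∀ i : Fin (j + 1), 0 < (i : ℕ) → (i : ℕ) < j →
        x₀ ∈ Ω \ closure (U i) ∧ x ∈ Ω \ closure (U i) ∧
        x ∉ connectedComponentIn (Ω \ closure (U i)) x₀) ∧
      -- (2)
      (∀ i : Fin (j + 1), 0 < (i : ℕ) → (i : ℕ) < j →
        ∀ γ' : ℝ → Euc n, ContinuousOn γ' (Icc 0 1) → MapsTo γ' (Icc 0 1) Ω →
          (∃ t ∈ Icc (0:ℝ) 1, γ' t = x) → (∃ t ∈ Icc (0:ℝ) 1, γ' t = x₀) →
          ENNReal.ofReal (diam (U i)) ≤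
            ENNReal.ofReal C * eVariationOn γ' {t ∈ Icc (0:ℝ) 1 | γ' t ∈ U i}) ∧
      -- (3)
      (∀ t ∈ Icc (0:ℝ) 1,
        ball (γ t) (infDist (γ t) (frontier Ω) / C) ⊆ ⋃ i, closure (U i)) ∧
      -- (4)
      (∀ i : Fin (j + 1), ∀ t ∈ Icc (0:ℝ) 1, γ t ∈ U i →
        diam (U i) ≤ C * infDist (γ t) (frontier Ω)) ∧
      (∀ i : Fin (j + 1), ∃ xi ∈ U i, (∃ t ∈ Icc (0:ℝ) 1, γ t = xi) ∧
        ((i : ℕ) = j → xi = x) ∧ ball xi (infDist xi (frontier Ω) / C) ⊆ U i)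

/-- `Ω` satisfies the slice condition. -/
def SliceCondition {n : ℕ} (Ω : Set (Euc n)) : Prop :=
  ∃ C : ℝ, 1 < C ∧ ∀ x₀ ∈ Ω, HasSliceProperty Ω C x₀

/-- `Ω` is LLC. -/
def IsLLC {n : ℕ} (Ω : Set (Euc n)) : Prop :=
  ∃ b : ℝ, 0 < b ∧ b ≤ 1 ∧ ∀ z : Euc n, ∀ r : ℝ, 0 < r →
    (∀ x ∈ Ω ∩ ball z r, ∀ y ∈ Ω ∩ ball z r, JoinedByCurveIn (Ω ∩ ball z (r / b)) x y) ∧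
    (∀ x ∈ Ω \ ball z r, ∀ y ∈ Ω \ ball z r, JoinedByCurveIn (Ω \ ball z (b * r)) x y)

/-- `Ω` is quasiconvex. -/
def IsQuasiconvex {n : ℕ} (Ω : Set (Euc n)) : Prop :=
  ∃ C : ℝ, 1 ≤ C ∧ ∀ x ∈ Ω, ∀ y ∈ Ω, ∃ γ : ℝ → Euc n,
    ContinuousOn γ (Icc 0 1) ∧ γ 0 = x ∧ γ 1 = y ∧ MapsTo γ (Icc 0 1) Ω ∧
    eVariationOn γ (Icc 0 1) ≤ ENNReal.ofReal (C * dist x y)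

/-- The intrinsic (inner) metric of `Ω` (`∞` if there is no rectifiable curve). -/
def intrinsicDist {n : ℕ} (Ω : Set (Euc n)) (x y : Euc n) : ℝ≥0∞ :=
  ⨅ (γ : ℝ → Euc n)
    (_ : ContinuousOn γ (Icc 0 1) ∧ γ 0 = x ∧ γ 1 = y ∧ MapsTo γ (Icc 0 1) Ω),
    eVariationOn γ (Icc 0 1)

/-- The intrinsic ball `B_Ω(x, r)`. -/
def intrinsicBall {n : ℕ} (Ω : Set (Euc n)) (x : Euc n) (r : ℝ) : Set (Euc n) :=
  {y ∈ Ω | intrinsicDist Ω x y < ENNReal.ofReal r}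

/-- `Ω` is intrinsic Ahlfors `n`-regular. -/
def IntrinsicAhlforsRegular {n : ℕ} (Ω : Set (Euc n)) : Prop :=
  ∃ c : ℝ, 0 < c ∧ c < 1 ∧ ∃ r₀ : ℝ, 0 < r₀ ∧ ∀ x ∈ Ω, ∀ r : ℝ, 0 < r → r < r₀ →
    ENNReal.ofReal c * volume (ball x r) ≤ volume (intrinsicBall Ω x r)

/-- `Ω` is a local Sobolev–Poincaré imbedding domain of order `p`, `1 ≤ p < n`. -/
def LocalSPLow (n : ℕ) (Ω : Set (Euc n)) (p : ℝ) : Prop :=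
  ∃ C : ℝ, 1 ≤ C ∧ ∃ lam : ℝ, 1 ≤ lam ∧
    ∀ u : Euc n → ℝ, LocallyLipschitzOnSet u Ω →
      ∀ x ∈ Ω, ∀ r : ℝ, 0 < r → r < diam Ω →
        (⨅ c : ℝ, (∫⁻ y in ball x r ∩ Ω,
            ENNReal.ofReal |u y - c| ^ ((n : ℝ) * p / ((n : ℝ) - p)) ∂volume)
              ^ (((n : ℝ) - p) / ((n : ℝ) * p)))
          ≤ ENNReal.ofReal C *
            (∫⁻ y in ball x (lam * r) ∩ Ω,
              ENNReal.ofReal ‖fderiv ℝ u y‖ ^ p ∂volume) ^ (1 / p)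

/-- `Ω` is a local Sobolev–Poincaré imbedding domain of order `n`
(local Trudinger inequality). -/
def LocalSPn (n : ℕ) (Ω : Set (Euc n)) : Prop :=
  ∃ C : ℝ, 1 ≤ C ∧ ∃ lam : ℝ, 1 ≤ lam ∧ ∃ A : ℝ, 0 < A ∧
    ∀ u : Euc n → ℝ, LocallyLipschitzOnSet u Ω →
      ∀ x ∈ Ω, ∀ r : ℝ, 0 < r → r < diam Ω →
        0 < (∫⁻ y in ball x (lam * r) ∩ Ω,
              ENNReal.ofReal ‖fderiv ℝ u y‖ ^ (n : ℝ) ∂volume) →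
        (∫⁻ y in ball x (lam * r) ∩ Ω,
              ENNReal.ofReal ‖fderiv ℝ u y‖ ^ (n : ℝ) ∂volume) < ⊤ →
        (⨅ c : ℝ, ∫⁻ y in ball x r ∩ Ω,
            ENNReal.ofReal (Real.exp ((A * |u y - c| /
              (∫⁻ z in ball x (lam * r) ∩ Ω,
                ENNReal.ofReal ‖fderiv ℝ u z‖ ^ (n : ℝ) ∂volume).toReal
                  ^ ((1 : ℝ) / (n : ℝ))) ^ ((n : ℝ) / ((n : ℝ) - 1)))) ∂volume)
          ≤ ENNReal.ofReal C * volume (ball x r)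

/-- `Ω` is a local Sobolev–Poincaré imbedding domain of order `p`, `n < p < ∞`
(local Morrey inequality). -/
def LocalSPHigh (n : ℕ) (Ω : Set (Euc n)) (p : ℝ) : Prop :=
  ∃ C : ℝ, 1 ≤ C ∧ ∃ lam : ℝ, 1 ≤ lam ∧
    ∀ u : Euc n → ℝ, LocallyLipschitzOnSet u Ω →
      ∀ x ∈ Ω, ∀ r : ℝ, 0 < r → r < diam Ω →
        ∀ x₁ ∈ ball x r ∩ Ω, ∀ x₂ ∈ ball x r ∩ Ω,
          ENNReal.ofReal |u x₁ - u x₂| ≤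
            ENNReal.ofReal (C * dist x₁ x₂ ^ (1 - (n : ℝ) / p)) *
              (∫⁻ y in ball x (lam * r) ∩ Ω,
                ENNReal.ofReal ‖fderiv ℝ u y‖ ^ p ∂volume) ^ (1 / p)

/-- `Ω` is a `p`-Poincaré domain. -/
def PoincareDomain (n : ℕ) (Ω : Set (Euc n)) (p : ℝ) : Prop :=
  ∃ C : ℝ, 1 ≤ C ∧ ∃ lam : ℝ, 1 ≤ lam ∧
    ∀ u : Euc n → ℝ, LocallyLipschitzOnSet u Ω →
      ∀ x ∈ Ω, ∀ r : ℝ, 0 < r → r < diam Ω →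
        (volume (ball x r ∩ Ω))⁻¹ *
          (∫⁻ y in ball x r ∩ Ω,
            ENNReal.ofReal |u y - ⨍ z in ball x r ∩ Ω, u z ∂volume| ∂volume)
          ≤ ENNReal.ofReal (C * r) *
            ((volume (ball x (lam * r) ∩ Ω))⁻¹ *
              ∫⁻ y in ball x (lam * r) ∩ Ω,
                ENNReal.ofReal ‖fderiv ℝ u y‖ ^ p ∂volume) ^ (1 / p)


theorem ae_differentiableAt_of_locallyLipschitzOn {n : ℕ} {u : Euc n → ℝ} {Ω : Set (Euc n)}
    (hΩ : IsOpen Ω) (hu : LocallyLipschitzOn Ω u) :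
    ∀ᵐ z, z ∈ Ω → DifferentiableAt ℝ u z := by
  rw [ae_iff]
  refine measure_null_of_locally_null _ fun x hx => ?_
  have hxΩ : x ∈ Ω := by
    by_contra h
    exact hx fun h' => absurd h' h
  obtain ⟨K, s, hs, hK⟩ := hu hxΩ
  rw [hΩ.nhdsWithin_eq hxΩ] at hs
  obtain ⟨t, hts, ht, hxt⟩ := _root_.mem_nhds_iff.1 hs
  refine ⟨{z | ¬ (z ∈ Ω → DifferentiableAt ℝ u z)} ∩ t,
    inter_mem_nhdsWithin _ (ht.mem_nhds hxt), ?_⟩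
  refine measure_mono_null ?_ (ae_iff.1 ((hK.mono hts).ae_differentiableWithinAt_of_mem))
  rintro z ⟨hz, hzt⟩ h
  exact hz fun _ => (h hzt).differentiableAt (ht.mem_nhds hzt)

theorem lintegral_comp_add_smul {n : ℕ} (f : Euc n → ℝ≥0∞) (hf : Measurable f)
    (a : Euc n) {ρ : ℝ} (hρ : 0 < ρ) :
    ∫⁻ h, f (a + ρ • h) = ENNReal.ofReal ((ρ ^ n)⁻¹) * ∫⁻ z, f z := by
  have h1 : ∫⁻ h, f (a + ρ • h) = ∫⁻ z, f (a + z) ∂(Measure.map (ρ • ·) volume) := by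
    rw [lintegral_map (by fun_prop) (by fun_prop)]
  rw [h1, Measure.map_addHaar_smul _ hρ.ne', lintegral_smul_measure,
    lintegral_add_left_eq_self f a, finrank_euclideanSpace_fin,
    abs_of_nonneg (by positivity), smul_eq_mul]

theorem edist_le_lintegral_deriv {f : ℝ → ℝ} {K : ℝ≥0} (hf : LipschitzOnWith K f (Icc 0 1)) :
    edist (f 0) (f 1) ≤ ∫⁻ t in Icc (0 : ℝ) 1, ‖deriv f t‖ₑ := by
  have hac : AbsolutelyContinuousOnInterval f 0 1 := by
    refine LipschitzOnWith.absolutelyContinuousOnInterval (K := K) ?_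
    rwa [uIcc_of_le zero_le_one]
  rw [edist_comm, edist_eq_enorm_sub, ← hac.integral_deriv_eq_sub,
    intervalIntegral.integral_of_le zero_le_one, ← integral_Icc_eq_integral_Ioc]
  exact enorm_integral_le_lintegral_enorm _

/-- The integral of `u` over the ball `B(p, ρ)`, rescaled to the unit ball. -/
def ballIntegral {n : ℕ} (u : Euc n → ℝ) (p : Euc n) (ρ : ℝ) : ℝ :=
  ∫ h in ball (0 : Euc n) 1, u (p + ρ • h)

theorem add_smul_mem_closedBall {n : ℕ} {p h : Euc n} {ρ : ℝ} (hρ : 0 ≤ ρ)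
    (hh : h ∈ closedBall (0 : Euc n) 1) : p + ρ • h ∈ closedBall p ρ := by
  rw [mem_closedBall_zero_iff] at hh
  rw [mem_closedBall_iff_norm, add_sub_cancel_left, norm_smul, Real.norm_of_nonneg hρ]
  nlinarith

theorem integrableOn_comp_add_smul {n : ℕ} {u : Euc n → ℝ} {Ω : Set (Euc n)}
    (hu : ContinuousOn u Ω) {p : Euc n} {ρ : ℝ} (hρ : 0 ≤ ρ) (hsub : closedBall p ρ ⊆ Ω) :
    IntegrableOn (fun h => u (p + ρ • h)) (ball (0 : Euc n) 1) := by
  refine (ContinuousOn.integrableOn_compact (isCompact_closedBall (0 : Euc n) 1) ?_).mono_set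
    ball_subset_closedBall
  refine hu.comp (by fun_prop) fun h hh => hsub (add_smul_mem_closedBall hρ hh)

theorem edist_comp_line_le {n : ℕ} {u : Euc n → ℝ} {Ω : Set (Euc n)} (hΩ : IsOpen Ω)
    (hu : LocallyLipschitzOn Ω u) (a v : Euc n)
    (hmem : ∀ t ∈ Icc (0 : ℝ) 1, a + t • v ∈ Ω)
    (hdiff : ∀ᵐ t, t ∈ Icc (0 : ℝ) 1 → DifferentiableAt ℝ u (a + t • v)) :
    edist (u a) (u (a + v)) ≤
      ∫⁻ t in Icc (0 : ℝ) 1, ‖v‖ₑ * ‖fderiv ℝ u (a + t • v)‖ₑ := by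
  have hline : LipschitzWith ‖v‖₊ (fun t : ℝ => a + t • v) := by
    refine LipschitzWith.of_dist_le_mul fun s t => ?_
    rw [dist_add_left, dist_eq_norm, ← sub_smul, norm_smul, mul_comm]
    rfl
  have hloc : LocallyLipschitzOn (Icc (0 : ℝ) 1) (fun t : ℝ => u (a + t • v)) := by
    intro t ht
    obtain ⟨K, s, hs, hK⟩ := hu (hmem t ht)
    rw [hΩ.nhdsWithin_eq (hmem t ht)] at hs
    refine ⟨K * ‖v‖₊, (fun t : ℝ => a + t • v) ⁻¹' s,
      mem_nhdsWithin_of_mem_nhds (hline.continuous.continuousAt.preimage_mem_nhds hs), ?_⟩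
    exact hK.comp hline.lipschitzOnWith (mapsTo_preimage _ _)
  obtain ⟨K, hK⟩ := hloc.exists_lipschitzOnWith_of_compact isCompact_Icc
  have h := edist_le_lintegral_deriv hK
  simp only [zero_smul, add_zero, one_smul] at h
  refine h.trans (setLIntegral_mono_ae' measurableSet_Icc ?_)
  filter_upwards [hdiff] with t ht htI
  have hd : HasDerivAt (fun t : ℝ => a + t • v) v t := by
    simpa using ((hasDerivAt_id t).smul_const v).const_add a
  have := ((ht htI).hasFDerivAt.comp_hasDerivAt t hd).deriv
  simp only [Function.comp_def] at this
  rw [this, mul_comm]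
  exact ContinuousLinearMap.le_opENorm _ _

theorem edist_ballIntegral_le {n : ℕ} {u : Euc n → ℝ} {Ω S : Set (Euc n)} (hΩ : IsOpen Ω)
    (hu : LocallyLipschitzOn Ω u) {p q : Euc n} {ρ σ ρ₀ : ℝ} (hρ₀ : 0 < ρ₀) (hρ : ρ₀ ≤ ρ)
    (hσ : ρ₀ ≤ σ) (hS : MeasurableSet S) (hSΩ : S ⊆ Ω)
    (hsub : ∀ t ∈ Icc (0 : ℝ) 1, closedBall (p + t • (q - p)) (ρ + t * (σ - ρ)) ⊆ S) :
    edist (ballIntegral u p ρ) (ballIntegral u q σ) ≤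
      ENNReal.ofReal ((dist p q + |σ - ρ|) * (ρ₀ ^ n)⁻¹) * ∫⁻ z in S, ‖fderiv ℝ u z‖ₑ := by
  have hrad : ∀ t ∈ Icc (0 : ℝ) 1, ρ₀ ≤ ρ + t * (σ - ρ) := fun t ht => by
    nlinarith [ht.1, ht.2]
  have hline : ∀ (h : Euc n) (t : ℝ), (p + ρ • h) + t • ((q - p) + (σ - ρ) • h)
      = (p + t • (q - p)) + (ρ + t * (σ - ρ)) • h := fun h t => by module
  set D : ℝ≥0∞ := ENNReal.ofReal (dist p q + |σ - ρ|) with hD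
  set G : Euc n → ℝ≥0∞ := fun z => ‖fderiv ℝ u z‖ₑ with hG
  have hGm : Measurable G := (measurable_fderiv ℝ u).enorm
  have hmem : ∀ h ∈ ball (0 : Euc n) 1, ∀ t ∈ Icc (0 : ℝ) 1,
      (p + t • (q - p)) + (ρ + t * (σ - ρ)) • h ∈ S := fun h hh t ht =>
    hsub t ht (add_smul_mem_closedBall (hρ₀.le.trans (hrad t ht)) (ball_subset_closedBall hh))
  have hcont : ContinuousOn u Ω := hu.continuousOn
  have hp : closedBall p ρ ⊆ Ω := by
    simpa using (hsub 0 (by simp)).trans hSΩ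
  have hq : closedBall q σ ⊆ Ω := by
    simpa using (hsub 1 (by simp)).trans hSΩ
  have hdiff : ∀ᵐ h : Euc n, ∀ᵐ t : ℝ, h ∈ ball (0 : Euc n) 1 → t ∈ Icc (0 : ℝ) 1 →
      DifferentiableAt ℝ u ((p + t • (q - p)) + (ρ + t * (σ - ρ)) • h) := by
    have hcts : Continuous fun x : Euc n × ℝ =>
        (p + x.2 • (q - p)) + (ρ + x.2 * (σ - ρ)) • x.1 := by fun_prop
    refine (Measure.ae_ae_comm (p := fun (h : Euc n) (t : ℝ) => h ∈ ball (0 : Euc n) 1 →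
      t ∈ Icc (0 : ℝ) 1 →
      DifferentiableAt ℝ u ((p + t • (q - p)) + (ρ + t * (σ - ρ)) • h)) ?_).2 ?_
    · have h1 : MeasurableSet {x : Euc n × ℝ | x.1 ∈ ball (0 : Euc n) 1} :=
        measurable_fst measurableSet_ball
      have h2 : MeasurableSet {x : Euc n × ℝ | x.2 ∈ Icc (0 : ℝ) 1} :=
        measurable_snd measurableSet_Icc
      have h3 : MeasurableSet {x : Euc n × ℝ | DifferentiableAt ℝ u
          ((p + x.2 • (q - p)) + (ρ + x.2 * (σ - ρ)) • x.1)} :=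
        hcts.measurable (measurableSet_of_differentiableAt ℝ u)
      exact h1.imp (h2.imp h3)
    · refine Filter.Eventually.of_forall fun t => ?_
      by_cases ht : t ∈ Icc (0 : ℝ) 1
      · have hr := hrad t ht
        have hnull := ae_iff.1 (ae_differentiableAt_of_locallyLipschitzOn hΩ hu)
        rw [ae_iff]
        refine measure_mono_null (t := (fun h : Euc n => (p + t • (q - p)) +
          (ρ + t * (σ - ρ)) • h) ⁻¹' {z | ¬ (z ∈ Ω → DifferentiableAt ℝ u z)}) ?_ ?_
        · intro h hh hc
          exact hh fun hb _ => hc (hSΩ (hmem h hb t ht))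
        · have hm : MeasurableSet (toMeasurable volume
            {z | ¬ (z ∈ Ω → DifferentiableAt ℝ u z)}) := measurableSet_toMeasurable _ _
          refine measure_mono_null (preimage_mono (subset_toMeasurable volume _)) ?_
          have hm' : Measurable fun h : Euc n => (p + t • (q - p)) + (ρ + t * (σ - ρ)) • h := by
            fun_prop
          have := lintegral_comp_add_smul ((toMeasurable volume
            {z | ¬ (z ∈ Ω → DifferentiableAt ℝ u z)}).indicator 1)
            (measurable_one.indicator hm) (p + t • (q - p)) (hρ₀.trans_le hr)
          rw [lintegral_indicator_one hm, measure_toMeasurable, hnull, mul_zero] at this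
          rw [← lintegral_indicator_one (hm' hm)]
          exact this
      · exact Filter.Eventually.of_forall fun h _ h2 => absurd h2 ht
  have hnorm : ∀ h ∈ ball (0 : Euc n) 1, ‖(q - p) + (σ - ρ) • h‖ₑ ≤ D := by
    intro h hh
    rw [← ofReal_norm]
    refine ENNReal.ofReal_le_ofReal ((norm_add_le _ _).trans ?_)
    rw [norm_smul, dist_comm, dist_eq_norm, Real.norm_eq_abs]
    have := (mem_ball_zero_iff.1 hh).le
    nlinarith [abs_nonneg (σ - ρ)]
  calc edist (ballIntegral u p ρ) (ballIntegral u q σ)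
      = ‖∫ h in ball (0 : Euc n) 1, (u (p + ρ • h) - u (q + σ • h))‖ₑ := by
        rw [edist_eq_enorm_sub, ballIntegral, ballIntegral, integral_sub
          (integrableOn_comp_add_smul hcont (hρ₀.le.trans hρ) hp)
          (integrableOn_comp_add_smul hcont (hρ₀.le.trans hσ) hq)]
    _ ≤ ∫⁻ h in ball (0 : Euc n) 1, ‖u (p + ρ • h) - u (q + σ • h)‖ₑ :=
        enorm_integral_le_lintegral_enorm _
    _ ≤ ∫⁻ h in ball (0 : Euc n) 1, ∫⁻ t in Icc (0 : ℝ) 1,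
          D * G ((p + t • (q - p)) + (ρ + t * (σ - ρ)) • h) := by
        refine setLIntegral_mono_ae' measurableSet_ball ?_
        filter_upwards [hdiff] with h hh hb
        have := edist_comp_line_le hΩ hu (p + ρ • h) ((q - p) + (σ - ρ) • h)
          (fun t ht => by rw [hline]; exact hSΩ (hmem h hb t ht))
          (by
            filter_upwards [hh] with t ht ht'
            rw [hline]
            exact ht hb ht')
        have h1 : p + ρ • h + (q - p + (σ - ρ) • h) = q + σ • h := by module
        rw [h1, edist_eq_enorm_sub] at this
        refine this.trans (lintegral_mono fun t => ?_)
        simp only [hline]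
        gcongr
        exact hnorm h hb
    _ = ∫⁻ t in Icc (0 : ℝ) 1, ∫⁻ h in ball (0 : Euc n) 1,
          D * G ((p + t • (q - p)) + (ρ + t * (σ - ρ)) • h) := by
        refine lintegral_lintegral_swap (Measurable.aemeasurable ?_)
        simp only [Function.uncurry_def]
        fun_prop
    _ ≤ ∫⁻ t in Icc (0 : ℝ) 1, D * (ENNReal.ofReal ((ρ₀ ^ n)⁻¹) * ∫⁻ z in S, G z) := by
        refine setLIntegral_mono' measurableSet_Icc fun t ht => ?_
        have hr := hrad t ht
        rw [lintegral_const_mul _ (by fun_prop)]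
        gcongr
        calc ∫⁻ h in ball (0 : Euc n) 1, G ((p + t • (q - p)) + (ρ + t * (σ - ρ)) • h)
            ≤ ∫⁻ h in ball (0 : Euc n) 1,
                S.indicator G ((p + t • (q - p)) + (ρ + t * (σ - ρ)) • h) := by
              refine setLIntegral_mono' measurableSet_ball fun h hb => ?_
              rw [indicator_of_mem (hmem h hb t ht)]
          _ ≤ ∫⁻ h, S.indicator G ((p + t • (q - p)) + (ρ + t * (σ - ρ)) • h) :=
              setLIntegral_le_lintegral _ _
          _ = ENNReal.ofReal (((ρ + t * (σ - ρ)) ^ n)⁻¹) * ∫⁻ z in S, G z := by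
              rw [lintegral_comp_add_smul _ (hGm.indicator hS) _ (hρ₀.trans_le hr),
                lintegral_indicator hS]
          _ ≤ _ := by gcongr
    _ = _ := by
        rw [setLIntegral_const, Real.volume_Icc, sub_zero, ENNReal.ofReal_one, mul_one,
          ← mul_assoc, hD, ← ENNReal.ofReal_mul (by positivity)]

theorem ball_infDist_frontier_subset {n : ℕ} {Ω : Set (Euc n)} (hΩ : IsOpen Ω) {z : Euc n}
    (hz : z ∈ Ω) : ball z (infDist z (frontier Ω)) ⊆ Ω := by
  rcases le_or_gt (infDist z (frontier Ω)) 0 with h | h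
  · rw [ball_eq_empty.2 h]
    exact empty_subset _
  · refine IsPreconnected.subset_left_of_subset_union hΩ isClosed_closure.isOpen_compl
      (disjoint_compl_right_iff_subset.2 subset_closure) ?_ ⟨z, mem_ball_self h, hz⟩
      (convex_ball _ _).isPreconnected
    intro w hw
    by_contra hc
    rw [mem_union, not_or, mem_compl_iff, not_not] at hc
    have hfr : w ∈ frontier Ω := ⟨hc.2, by rw [hΩ.interior_eq]; exact hc.1⟩
    have := infDist_le_dist_of_mem (x := z) hfr
    rw [mem_ball, dist_comm] at hw
    linarith

theorem IsUniformWith.exists_corkscrew {n : ℕ} {Ω : Set (Euc n)} {ε₀ : ℝ}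
    (hU : IsUniformWith Ω ε₀) (hε₀ : 0 < ε₀) {r s : ℝ} (hr : r < diam Ω) {y : Euc n}
    (hy : y ∈ Ω) (hs : 0 < s) (hsr : s ≤ r / 4) :
    ∃ z ∈ Ω, dist y z = s ∧ ε₀ * s / 2 ≤ infDist z (frontier Ω) := by
  have hfar : ∃ p ∈ Ω, r / 2 ≤ dist y p := by
    by_contra! hc
    refine absurd (diam_le_of_forall_dist_le (C := r) (by linarith) fun a ha b hb => ?_) hr.not_ge
    have := dist_triangle_left a b y
    linarith [hc a ha, hc b hb]
  obtain ⟨p, hp, hyp⟩ := hfar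
  obtain ⟨γ, hγ, h0, h1, hmaps, -, hcig⟩ := hU y hy p hp
  have hivt := intermediate_value_Icc zero_le_one
    (f := fun t => dist y (γ t)) (by fun_prop)
  simp only [h0, h1, dist_self] at hivt
  obtain ⟨t, ht, hts⟩ := hivt ⟨hs.le, by linarith⟩
  simp only at hts
  refine ⟨γ t, hmaps ht, hts, le_trans ?_ (hcig t ht)⟩
  have hpt : dist y p / 2 ≤ dist p (γ t) := by
    have := dist_triangle_right y p (γ t)
    linarith
  have hyp0 : 0 < dist y p := by linarith
  rw [hts, le_div_iff₀ hyp0]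
  have : 0 < ε₀ * s := by positivity
  nlinarith

theorem edist_ballIntegral_le_of_curve {n : ℕ} {u : Euc n → ℝ} {Ω : Set (Euc n)} (hΩ : IsOpen Ω)
    (hu : LocallyLipschitzOn Ω u) {ε₀ : ℝ} (hU : IsUniformWith Ω ε₀) (hε₀ : 0 < ε₀)
    (hε₁ : ε₀ ≤ 1) {z w : Euc n} (hz : z ∈ Ω) (hw : w ∈ Ω) {s τ : ℝ} (hs : 0 < s)
    (hzw : dist z w ≤ 6 * s) (hzd : ε₀ * s / 4 ≤ infDist z (frontier Ω))
    (hwd : ε₀ * s / 4 ≤ infDist w (frontier Ω)) (hτ : 0 < τ) (hτs : τ ≤ ε₀ ^ 2 * s / 64) :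
    edist (ballIntegral u z τ) (ballIntegral u w τ) ≤
      ENNReal.ofReal (6 * s / ε₀ * (τ ^ n)⁻¹) *
        ∫⁻ x in ball z (7 * s / ε₀) ∩ Ω, ‖fderiv ℝ u x‖ₑ := by
  obtain ⟨γ, hγ, h0, h1, hmaps, hlen, hcig⟩ := hU z hz w hw
  have hεs : 0 < ε₀ * s := by positivity
  have hε2 : ε₀ ^ 2 * s ≤ ε₀ * s := by nlinarith
  have hε2' : 0 < ε₀ ^ 2 * s := by positivity
  have hlen' : dist z w / ε₀ ≤ 6 * s / ε₀ := by gcongr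
  have hin : ∀ t ∈ Icc (0 : ℝ) 1, dist (γ t) z ≤ 6 * s / ε₀ := by
    intro t ht
    have h := (eVariationOn.edist_le γ ht (left_mem_Icc.2 zero_le_one)).trans hlen
    rw [h0, edist_dist] at h
    exact ((ENNReal.ofReal_le_ofReal_iff (by positivity)).1 h).trans hlen'
  have hdepth : ∀ t ∈ Icc (0 : ℝ) 1, ε₀ ^ 2 * s / 16 ≤ infDist (γ t) (frontier Ω) := by
    intro t ht
    have hz' := infDist_le_infDist_add_dist (s := frontier Ω) (x := z) (y := γ t)
    have hw' := infDist_le_infDist_add_dist (s := frontier Ω) (x := w) (y := γ t)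
    by_cases hzt : dist z (γ t) ≤ ε₀ * s / 8
    · linarith
    by_cases hwt : dist w (γ t) ≤ ε₀ * s / 8
    · linarith
    push Not at hzt hwt
    refine le_trans ?_ (hcig t ht)
    have htri := dist_triangle_right z w (γ t)
    have hpos : ε₀ * s / 16 * dist z w ≤ dist z (γ t) * dist w (γ t) := by
      rcases le_total (dist z (γ t)) (dist w (γ t)) with h | h <;> nlinarith
    rcases (dist_nonneg (x := z) (y := w)).eq_or_lt with h | h
    · rw [← h] at hpos
      have hzw' : z = w := dist_eq_zero.1 h.symm
      have hγz : eVariationOn γ (Icc 0 1) ≤ 0 := by simpa [← h] using hlen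
      have := (eVariationOn.edist_le γ ht (left_mem_Icc.2 zero_le_one)).trans hγz
      rw [h0, edist_dist, nonpos_iff_eq_zero, ENNReal.ofReal_eq_zero, dist_comm] at this
      linarith
    · rw [le_div_iff₀ h]
      nlinarith
  set S : Set (Euc n) := ball z (7 * s / ε₀) ∩ Ω with hS
  have hSm : MeasurableSet S := (isOpen_ball.inter hΩ).measurableSet
  set A : ℝ≥0∞ := ENNReal.ofReal ((τ ^ n)⁻¹) * ∫⁻ x in S, ‖fderiv ℝ u x‖ₑ with hA
  have hstep : ∀ t ∈ Icc (0 : ℝ) 1, ∀ t' ∈ Icc (0 : ℝ) 1,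
      dist (γ t) (γ t') < ε₀ ^ 2 * s / 64 →
      edist (ballIntegral u (γ t) τ) (ballIntegral u (γ t') τ) ≤ edist (γ t) (γ t') * A := by
    intro t ht t' ht' hd
    have := edist_ballIntegral_le hΩ hu (p := γ t) (q := γ t') hτ le_rfl le_rfl hSm
      inter_subset_right (fun a ha x hx => by
        rw [sub_self, mul_zero, add_zero, mem_closedBall] at hx
        have hpa : dist (γ t + a • (γ t' - γ t)) (γ t) ≤ dist (γ t) (γ t') := by
          rw [dist_self_add_left, norm_smul, Real.norm_of_nonneg ha.1, dist_comm, dist_eq_norm]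
          nlinarith [ha.2, norm_nonneg (γ t' - γ t)]
        have hxt := dist_triangle x (γ t + a • (γ t' - γ t)) (γ t)
        refine ⟨?_, ball_infDist_frontier_subset hΩ (hmaps ht) ?_⟩
        · have h3 := dist_triangle x (γ t) z
          have h4 := hin t ht
          have h5 : s ≤ s / ε₀ := by
            rw [le_div_iff₀ hε₀]
            nlinarith
          have h6 : 7 * s / ε₀ = 6 * s / ε₀ + s / ε₀ := by ring
          have h7 : ε₀ * s ≤ s := by nlinarith
          rw [mem_ball]
          linarith
        · have := hdepth t ht
          rw [mem_ball]
          linarith)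
    rwa [sub_self, abs_zero, add_zero, ENNReal.ofReal_mul dist_nonneg, ← edist_dist,
      mul_assoc] at this
  have huc := isCompact_Icc.uniformContinuousOn_of_continuous hγ
  obtain ⟨δ, hδ, hδ'⟩ := Metric.uniformContinuousOn_iff.1 huc (ε₀ ^ 2 * s / 64) (by positivity)
  obtain ⟨N, hN⟩ := exists_nat_one_div_lt hδ
  have hN0 : (0 : ℝ) < N + 1 := by positivity
  have hmono : MonotoneOn (fun i : ℕ => (i : ℝ) / (N + 1)) (Iic (N + 1)) := fun i _ j _ hij => by
    dsimp only
    gcongr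
  have hmem : ∀ i ≤ N + 1, (fun i : ℕ => (i : ℝ) / (N + 1)) i ∈ Icc (0 : ℝ) 1 := fun i hi => by
    refine ⟨by positivity, (div_le_one hN0).2 ?_⟩
    exact_mod_cast hi
  have hsum := eVariationOn.sum_le_of_monotoneOn_Iic (f := γ) hmono hmem
  have hchain := edist_le_range_sum_edist
    (fun i : ℕ => ballIntegral u (γ ((i : ℝ) / (N + 1))) τ) (N + 1)
  simp only [Nat.cast_zero, zero_div, h0, Nat.cast_add, Nat.cast_one, div_self hN0.ne', h1]
    at hchain
  refine hchain.trans ?_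
  calc _ ≤ ∑ i ∈ Finset.range (N + 1),
          edist (γ (((i + 1 : ℕ) : ℝ) / (N + 1))) (γ ((i : ℝ) / (N + 1))) * A := by
        refine Finset.sum_le_sum fun i hi => ?_
        rw [Finset.mem_range] at hi
        have hi0 := hmem i hi.le
        have hi1 := hmem (i + 1) hi
        rw [edist_comm (γ (((i + 1 : ℕ) : ℝ) / (N + 1)))]
        have := hstep _ hi0 _ hi1 (hδ' _ hi0 _ hi1 (by
          rw [dist_comm, Real.dist_eq]
          dsimp only
          rw [← _root_.sub_div, Nat.cast_succ, add_sub_cancel_left,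
            abs_of_pos (by positivity)]
          exact hN))
        simpa using this
    _ ≤ ENNReal.ofReal (dist z w / ε₀) * A := by
        rw [← Finset.sum_mul]
        gcongr
        exact hsum.trans hlen
    _ ≤ ENNReal.ofReal (6 * s / ε₀) * A := by gcongr
    _ = _ := by rw [hA, ← mul_assoc, ENNReal.ofReal_mul (by positivity)]

theorem tendsto_ballIntegral {n : ℕ} {u : Euc n → ℝ} {Ω : Set (Euc n)} (hu : ContinuousOn u Ω)
    {y : Euc n} (huy : ContinuousAt u y) {z : ℕ → Euc n} {τ : ℕ → ℝ} (hτ : ∀ i, 0 ≤ τ i)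
    (hsub : ∀ i, closedBall (z i) (τ i) ⊆ Ω) (hz : Filter.Tendsto z Filter.atTop (nhds y))
    (hτ0 : Filter.Tendsto τ Filter.atTop (nhds 0)) :
    Filter.Tendsto (fun i => ballIntegral u (z i) (τ i)) Filter.atTop
      (nhds (volume.real (ball (0 : Euc n) 1) * u y)) := by
  set ω := volume.real (ball (0 : Euc n) 1) with hω
  have hω0 : 0 ≤ ω := measureReal_nonneg
  rw [Metric.tendsto_atTop]
  intro ε hε
  obtain ⟨δ, hδ, hδu⟩ := Metric.continuousAt_iff.1 huy (ε / (ω + 1)) (by positivity)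
  obtain ⟨N₁, hN₁⟩ := Metric.tendsto_atTop.1 hz (δ / 2) (by positivity)
  obtain ⟨N₂, hN₂⟩ := Metric.tendsto_atTop.1 hτ0 (δ / 2) (by positivity)
  refine ⟨max N₁ N₂, fun i hi => ?_⟩
  have h1 := hN₁ i (le_of_max_le_left hi)
  have h2 := hN₂ i (le_of_max_le_right hi)
  rw [Real.dist_0_eq_abs, abs_of_nonneg (hτ i)] at h2
  have hfin : volume (ball (0 : Euc n) 1) < ⊤ := measure_ball_lt_top
  have hconst : ω * u y = ∫ _ in ball (0 : Euc n) 1, u y := by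
    rw [setIntegral_const, smul_eq_mul]
  rw [hconst, dist_eq_norm, ballIntegral, ← integral_sub
    (integrableOn_comp_add_smul hu (hτ i) (hsub i)) (integrableOn_const hfin.ne)]
  refine (norm_setIntegral_le_of_norm_le_const (C := ε / (ω + 1)) hfin fun h hh => ?_).trans_lt ?_
  · rw [← dist_eq_norm]
    refine (hδu ?_).le
    have h3 := add_smul_mem_closedBall (p := z i) (hτ i) (ball_subset_closedBall hh)
    rw [mem_closedBall] at h3
    linarith [dist_triangle (z i + τ i • h) (z i) y]
  · rw [← hω, div_mul_eq_mul_div, div_lt_iff₀ (by positivity)]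
    nlinarith

theorem edist_ballIntegral_le_tsum {n : ℕ} {u : Euc n → ℝ} {Ω : Set (Euc n)} (hΩ : IsOpen Ω)
    (hu : LocallyLipschitzOn Ω u) {ε₀ : ℝ} (hU : IsUniformWith Ω ε₀) (hε₀ : 0 < ε₀)
    (hε₁ : ε₀ ≤ 1) {s₀ : ℝ} (hs₀ : 0 < s₀) {s : ℕ → ℝ}
    (hs : ∀ i, s i = s₀ * (1 / 2) ^ i) (hdiam : 4 * s₀ < diam Ω) {y z₀ : Euc n} (hy : y ∈ Ω)
    (hz₀ : z₀ ∈ Ω) (hyz : dist y z₀ ≤ 5 * s₀)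
    (hzd : ε₀ * s₀ / 4 ≤ infDist z₀ (frontier Ω)) :
    edist (ballIntegral u z₀ (ε₀ ^ 2 / 64 * s₀)) (volume.real (ball (0 : Euc n) 1) * u y) ≤
      ENNReal.ofReal (3 * (6 / ε₀ * (128 / ε₀ ^ 2) ^ n)) *
        ∑' i : ℕ, ENNReal.ofReal (s i * (s i ^ n)⁻¹) *
          ∫⁻ x in ball y (8 / ε₀ * s i) ∩ Ω, ‖fderiv ℝ u x‖ₑ := by
  have hspos : ∀ i, 0 < s i := fun i => by rw [hs]; positivity
  have hsucc : ∀ i, s (i + 1) = s i / 2 := fun i => by rw [hs, hs]; ring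
  have hsle : ∀ i, s i ≤ s₀ := fun i => (hs i).trans_le <|
    mul_le_of_le_one_right hs₀.le (pow_le_one₀ (by norm_num) (by norm_num))
  have hs00 : s 0 = s₀ := by simp [hs]
  have hs0 : Filter.Tendsto s Filter.atTop (nhds 0) := by
    rw [funext hs]
    simpa only [mul_zero] using (tendsto_pow_atTop_nhds_zero_of_lt_one (r := (1 / 2 : ℝ))
      (by norm_num) (by norm_num)).const_mul s₀
  set κ : ℝ := ε₀ ^ 2 / 64 with hκ
  have hκ0 : 0 < κ := by positivity
  set C₀ : ℝ := 6 / ε₀ * (128 / ε₀ ^ 2) ^ n with hC₀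
  have hC₀0 : 0 < C₀ := by positivity
  have hκε : κ ≤ ε₀ / 64 := by rw [hκ]; nlinarith
  choose z hzΩ hzs hzdist using fun i => hU.exists_corkscrew hε₀ hdiam hy (hspos i)
    (by linarith [hsle i])
  set J : ℕ → ℝ≥0∞ := fun i => ∫⁻ x in ball y (8 / ε₀ * s i) ∩ Ω, ‖fderiv ℝ u x‖ₑ with hJ
  have hεge : ∀ i, s i ≤ s i / ε₀ := fun i => by
    rw [le_div_iff₀ hε₀]
    nlinarith [hspos i]
  have hballs : ∀ i w, dist w y ≤ s i →
      ball w (7 * s i / ε₀) ∩ Ω ⊆ ball y (8 / ε₀ * s i) ∩ Ω := by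
    intro i w hw
    refine inter_subset_inter_left _ (ball_subset_ball' ?_)
    have : 8 / ε₀ * s i = 7 * s i / ε₀ + s i / ε₀ := by ring
    linarith [hεge i]
  have hcurve : ∀ i w, w ∈ Ω → dist (z i) w ≤ 6 * s i → ε₀ * s i / 4 ≤ infDist w (frontier Ω) →
      edist (ballIntegral u (z i) (κ * s i)) (ballIntegral u w (κ * s i)) ≤
        ENNReal.ofReal C₀ * (ENNReal.ofReal (s i * ((s i) ^ n)⁻¹) * J i) := by
    intro i w hw hd hwd
    have hsi := hspos i
    refine (edist_ballIntegral_le_of_curve hΩ hu hU hε₀ hε₁ (hzΩ i) hw hsi hd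
      (by have := hzdist i; nlinarith [mul_pos hε₀ hsi]) hwd (by positivity)
      (by rw [hκ]; linarith)).trans ?_
    rw [← mul_assoc, ← ENNReal.ofReal_mul hC₀0.le]
    refine mul_le_mul' (ENNReal.ofReal_le_ofReal ?_)
      (lintegral_mono_set (hballs i _ (by rw [dist_comm, hzs])))
    have e1 : (κ * s i) ^ n = κ ^ n * s i ^ n := mul_pow _ _ _
    have e2 : 6 * s i / ε₀ * ((κ * s i) ^ n)⁻¹ =
        6 / ε₀ * (64 / ε₀ ^ 2) ^ n * (s i * (s i ^ n)⁻¹) := by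
      rw [e1, mul_inv, hκ, ← inv_pow, inv_div]
      ring
    rw [e2, hC₀]
    gcongr
    norm_num
  have hradius : ∀ i, edist (ballIntegral u (z (i + 1)) (κ * s i))
      (ballIntegral u (z (i + 1)) (κ * s (i + 1))) ≤
        ENNReal.ofReal C₀ * (ENNReal.ofReal (s i * ((s i) ^ n)⁻¹) * J i) := by
    intro i
    have hsi := hspos i
    refine (edist_ballIntegral_le hΩ hu (S := ball y (8 / ε₀ * s i) ∩ Ω) (ρ₀ := κ * s (i + 1))
      (by have := hspos (i + 1); positivity) ?_ le_rfl (isOpen_ball.inter hΩ).measurableSet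
      inter_subset_right ?_).trans ?_
    · rw [hsucc]
      nlinarith
    · intro t ht
      have hrad : κ * s i + t * (κ * s (i + 1) - κ * s i) ≤ κ * s i := by
        rw [hsucc]
        nlinarith [ht.1, mul_pos hκ0 hsi, mul_nonneg ht.1 (mul_pos hκ0 hsi).le]
      rw [sub_self, smul_zero, add_zero]
      refine (closedBall_subset_closedBall hrad).trans (Subset.trans ?_ (hballs i (z (i + 1)) ?_))
      · have hκs : κ * s i ≤ ε₀ / 64 * s i := by gcongr
        have hεs := mul_pos hε₀ hsi
        have hεs' : ε₀ * s i ≤ s i := by nlinarith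
        refine subset_inter (closedBall_subset_ball ?_) ((closedBall_subset_ball ?_).trans
          (ball_infDist_frontier_subset hΩ (hzΩ (i + 1))))
        · have : 7 * s i / ε₀ = 7 * (s i / ε₀) := by ring
          linarith [hεge i]
        · have := hzdist (i + 1)
          rw [hsucc] at this
          linarith
      · rw [dist_comm, hzs, hsucc]
        linarith
    · rw [← mul_assoc, ← ENNReal.ofReal_mul hC₀0.le]
      refine mul_le_mul' (ENNReal.ofReal_le_ofReal ?_) le_rfl
      have e2 : (κ * s (i + 1)) ^ n = (ε₀ ^ 2 / 128) ^ n * s i ^ n := by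
        rw [← mul_pow, hκ, hsucc]
        ring
      have e3 : |κ * s (i + 1) - κ * s i| = κ / 2 * s i := by
        rw [hsucc, abs_of_nonpos (by nlinarith)]
        ring
      have e4 : κ / 2 ≤ 6 / ε₀ := by
        rw [le_div_iff₀ hε₀]
        nlinarith
      rw [dist_self, zero_add, e2, e3, mul_inv, ← inv_pow, inv_div, hC₀]
      calc κ / 2 * s i * ((128 / ε₀ ^ 2) ^ n * (s i ^ n)⁻¹)
          ≤ 6 / ε₀ * s i * ((128 / ε₀ ^ 2) ^ n * (s i ^ n)⁻¹) := by gcongr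
        _ = _ := by ring
  have hstep : ∀ i, edist (ballIntegral u (z i) (κ * s i))
      (ballIntegral u (z (i + 1)) (κ * s (i + 1))) ≤
        ENNReal.ofReal (2 * C₀) * (ENNReal.ofReal (s i * ((s i) ^ n)⁻¹) * J i) := by
    intro i
    have hsi := hspos i
    have h1 := hcurve i (z (i + 1)) (hzΩ _) (by
      have := dist_triangle_left (z i) (z (i + 1)) y
      rw [hzs, hzs, hsucc] at this
      linarith) (by
      have := hzdist (i + 1)
      rw [hsucc] at this
      linarith)
    refine (edist_triangle _ _ _).trans ((add_le_add h1 (hradius i)).trans_eq ?_)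
    rw [ENNReal.ofReal_mul zero_le_two, ENNReal.ofReal_ofNat, ← two_mul, mul_assoc]
  have hlim : Filter.Tendsto (fun i => ballIntegral u (z i) (κ * s i)) Filter.atTop
      (nhds (volume.real (ball (0 : Euc n) 1) * u y)) := by
    refine tendsto_ballIntegral hu.continuousOn
      (hu.continuousOn.continuousAt (hΩ.mem_nhds hy)) (fun i => ?_) (fun i => ?_) ?_ ?_
    · have := hspos i
      positivity
    · refine (closedBall_subset_ball ?_).trans (ball_infDist_frontier_subset hΩ (hzΩ i))
      have h1 := hzdist i
      have h2 : κ * s i ≤ ε₀ / 64 * s i := by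
        have := hspos i
        gcongr
      have := mul_pos hε₀ (hspos i)
      linarith
    · rw [tendsto_iff_dist_tendsto_zero]
      simpa only [dist_comm _ y, hzs] using hs0
    · simpa using hs0.const_mul κ
  have htail := edist_le_tsum_of_edist_le_of_tendsto₀ _ hstep hlim
  rw [ENNReal.tsum_mul_left] at htail
  have hcentral := hcurve 0 z₀ hz₀ (by
    have := dist_triangle_left (z 0) z₀ y
    rw [hzs, hs00] at this
    rw [hs00]
    linarith) (by rwa [hs00])
  have hfirst := ENNReal.le_tsum (f := fun i => ENNReal.ofReal (s i * ((s i) ^ n)⁻¹) * J i) 0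
  rw [hs00] at hcentral htail
  refine (edist_triangle _ (ballIntegral u (z 0) (κ * s₀)) _).trans ?_
  rw [edist_comm (ballIntegral u z₀ _)]
  have h3 : ENNReal.ofReal (3 * C₀) = ENNReal.ofReal C₀ + ENNReal.ofReal (2 * C₀) := by
    rw [← ENNReal.ofReal_add hC₀0.le (by positivity)]
    congr 1
    ring
  rw [h3, add_mul]
  refine add_le_add (hcentral.trans ?_) htail
  gcongr
  rw [hs00] at hfirst
  exact hfirst

theorem exp_half_div_two_lt_one : Real.exp (1 / 2) / 2 < 1 := by
  have h1 : Real.exp (1 / 2) * Real.exp (1 / 2) = Real.exp 1 := by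
    rw [← Real.exp_add]
    norm_num
  have h2 := Real.exp_one_lt_three
  nlinarith [Real.exp_pos (1 / 2)]

theorem lintegral_exp_le_of_superlevel {α : Type*} [MeasurableSpace α] {μ : Measure α}
    {S : Set α} (hS : MeasurableSet S) {E : ℕ → Set α} (hE : ∀ N, MeasurableSet (E N))
    {F : α → ℝ} {V : ℝ≥0∞} {C : ℝ} (hC : 0 ≤ C)
    (hF : ∀ N : ℕ, ∀ y ∈ S, y ∉ E N → F y ≤ (N + 1) / 2)
    (hμE : ∀ N, μ (E N) ≤ ENNReal.ofReal (C * (1 / 2) ^ N) * V) (hμS : μ S ≤ V) :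
    ∫⁻ y in S, ENNReal.ofReal (Real.exp (F y)) ∂μ ≤
      ENNReal.ofReal (Real.exp (1 / 2) + C * Real.exp 1 / (1 - Real.exp (1 / 2) / 2)) * V := by
  have hexp := exp_half_div_two_lt_one
  have hexp0 : 0 ≤ Real.exp (1 / 2) / 2 := by positivity
  set c : ℕ → ℝ≥0∞ := fun N => ENNReal.ofReal (Real.exp ((N + 2) / 2)) with hc
  have hpt : ∀ y ∈ S, ENNReal.ofReal (Real.exp (F y)) ≤
      ENNReal.ofReal (Real.exp (1 / 2)) + ∑' N, (E N).indicator (fun _ => c N) y := by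
    intro y hy
    by_cases h : ∃ N, y ∉ E N
    · classical
      have hmin := fun m => Nat.find_min (m := m) h
      have hspec := hF _ y hy (Nat.find_spec h)
      rcases hN : Nat.find h with _ | k
      · rw [hN] at hspec
        refine le_add_right (ENNReal.ofReal_le_ofReal (Real.exp_le_exp.2 ?_))
        simpa using hspec
      · rw [hN] at hspec
        have hk : y ∈ E k := by
          by_contra hk
          exact hmin k (by omega) hk
        refine le_add_left (le_trans ?_ (ENNReal.le_tsum k))
        rw [indicator_of_mem hk]
        refine ENNReal.ofReal_le_ofReal (Real.exp_le_exp.2 (hspec.trans_eq ?_))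
        push_cast
        ring
    · push Not at h
      have h1 : ∑' N, (E N).indicator (fun _ => c N) y = ⊤ := by
        refine top_unique ?_
        rw [← ENNReal.tsum_const_eq_top_of_ne_zero (α := ℕ) one_ne_zero]
        refine ENNReal.tsum_le_tsum fun N => ?_
        rw [indicator_of_mem (h N), hc, ENNReal.one_le_ofReal]
        exact Real.one_le_exp (by positivity)
      rw [h1, add_top]
      exact le_top
  have hsum : ∑' N, c N * ENNReal.ofReal (C * (1 / 2) ^ N) =
      ENNReal.ofReal (C * Real.exp 1 / (1 - Real.exp (1 / 2) / 2)) := by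
    have hgeom : C * Real.exp 1 / (1 - Real.exp (1 / 2) / 2) =
        ∑' N : ℕ, C * Real.exp 1 * (Real.exp (1 / 2) / 2) ^ N := by
      rw [_root_.tsum_mul_left, tsum_geometric_of_lt_one hexp0 hexp, div_eq_mul_inv]
    rw [hgeom, ENNReal.ofReal_tsum_of_nonneg (fun N => by positivity)
        ((summable_geometric_of_lt_one hexp0 hexp).mul_left _)]
    refine tsum_congr fun N => ?_
    rw [hc, ← ENNReal.ofReal_mul (Real.exp_pos _).le]
    congr 1
    have : Real.exp ((N + 2) / 2) = Real.exp 1 * Real.exp (1 / 2) ^ N := by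
      rw [← Real.exp_nat_mul, ← Real.exp_add]
      congr 1
      ring
    rw [this, div_pow, div_pow, one_pow]
    ring
  calc ∫⁻ y in S, ENNReal.ofReal (Real.exp (F y)) ∂μ
      ≤ ∫⁻ y in S, (ENNReal.ofReal (Real.exp (1 / 2)) +
          ∑' N, (E N).indicator (fun _ => c N) y) ∂μ := setLIntegral_mono' hS hpt
    _ = ENNReal.ofReal (Real.exp (1 / 2)) * μ S +
          ∑' N, ∫⁻ y in S, (E N).indicator (fun _ => c N) y ∂μ := by
        rw [lintegral_add_left measurable_const, setLIntegral_const,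
          lintegral_tsum fun N => (measurable_const.indicator (hE N)).aemeasurable]
    _ ≤ ENNReal.ofReal (Real.exp (1 / 2)) * V +
          ∑' N, c N * (ENNReal.ofReal (C * (1 / 2) ^ N) * V) := by
        refine add_le_add (by gcongr) (ENNReal.tsum_le_tsum fun N => ?_)
        refine (setLIntegral_le_lintegral _ _).trans ?_
        rw [lintegral_indicator_const (hE N)]
        exact mul_le_mul' le_rfl (hμE N)
    _ = _ := by
        simp_rw [← mul_assoc]
        rw [ENNReal.tsum_mul_right, hsum, ← add_mul, ENNReal.ofReal_add (by positivity)]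
        exact div_nonneg (by positivity) (by linarith)

theorem sum_indicator_rpow_le {α : Type*} {a : ℕ → ℝ≥0∞} (ha : ∀ i, 2 * a i ≤ a (i + 1))
    (B : ℕ → Set α) {p : ℝ} (hp : 0 < p) (z : α) (N : ℕ) :
    (∑ i ∈ Finset.range N, (B i).indicator (fun _ => a i) z) ^ p ≤
      2 ^ p * ∑ i ∈ Finset.range N, (B i).indicator (fun _ => a i ^ p) z := by
  have hlast : ∀ N, ∑ i ∈ Finset.range N, (B i).indicator (fun _ => a i) z ≤ a N := by
    intro N
    induction N with
    | zero => simp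
    | succ N ih =>
      rw [Finset.sum_range_succ]
      refine le_trans ?_ (ha N)
      rw [two_mul]
      exact add_le_add ih (indicator_apply_le' (fun _ => le_rfl) fun _ => zero_le)
  induction N with
  | zero => simp [hp]
  | succ N ih =>
    rw [Finset.sum_range_succ, Finset.sum_range_succ]
    by_cases hz : z ∈ B N
    · rw [indicator_of_mem hz, indicator_of_mem hz, mul_add]
      refine le_add_left ?_
      rw [← ENNReal.mul_rpow_of_nonneg _ _ hp.le, two_mul]
      gcongr
      exact hlast N
    · rwa [indicator_of_notMem hz, indicator_of_notMem hz, add_zero, add_zero]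

theorem sum_mul_setLIntegral_le {α : Type*} [MeasurableSpace α] {μ : Measure α}
    {g : α → ℝ≥0∞} (hg : Measurable g) {a : ℕ → ℝ≥0∞} (ha : ∀ i, 2 * a i ≤ a (i + 1))
    {B : ℕ → Set α} (hB : ∀ i, MeasurableSet (B i)) {p q : ℝ} (hqp : q.HolderConjugate p)
    (N : ℕ) :
    ∑ i ∈ Finset.range N, a i * ∫⁻ z in B i, g z ∂μ ≤
      (∫⁻ z, g z ^ q ∂μ) ^ (1 / q) *
        (2 ^ p * ∑ i ∈ Finset.range N, a i ^ p * μ (B i)) ^ (1 / p) := by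
  have hm : ∀ (c : ℕ → ℝ≥0∞) (i : ℕ), Measurable ((B i).indicator fun _ => c i) :=
    fun c i => measurable_const.indicator (hB i)
  calc ∑ i ∈ Finset.range N, a i * ∫⁻ z in B i, g z ∂μ
      = ∫⁻ z, (g * fun z => ∑ i ∈ Finset.range N, (B i).indicator (fun _ => a i) z) z ∂μ := by
        simp_rw [Pi.mul_apply, Finset.mul_sum]
        rw [lintegral_finsetSum (Finset.range N)
          (f := fun i z => g z * (B i).indicator (fun _ => a i) z) fun i _ => hg.mul (hm a i)]
        refine Finset.sum_congr rfl fun i _ => ?_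
        rw [← lintegral_indicator (hB i), ← lintegral_const_mul _ (hg.indicator (hB i))]
        refine lintegral_congr fun z => ?_
        by_cases hz : z ∈ B i <;> simp [hz, mul_comm]
    _ ≤ (∫⁻ z, g z ^ q ∂μ) ^ (1 / q) * (∫⁻ z, (∑ i ∈ Finset.range N,
          (B i).indicator (fun _ => a i) z) ^ p ∂μ) ^ (1 / p) :=
        ENNReal.lintegral_mul_le_Lp_mul_Lq μ hqp hg.aemeasurable
          (Finset.measurable_sum _ fun i _ => hm a i).aemeasurable
    _ ≤ _ := by
        refine mul_le_mul' le_rfl (ENNReal.rpow_le_rpow ?_ (one_div_nonneg.2 hqp.symm.nonneg))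
        refine (lintegral_mono fun z => sum_indicator_rpow_le ha B hqp.symm.pos z N).trans_eq ?_
        rw [lintegral_const_mul _ (Finset.measurable_sum _ fun i _ => hm (fun i => a i ^ p) i),
          lintegral_finsetSum _ fun i _ => hm (fun i => a i ^ p) i]
        simp_rw [lintegral_indicator_const (hB _)]

theorem setLIntegral_ball_eq {n : ℕ} (g : Euc n → ℝ≥0∞) (R : ℝ) (y : Euc n) :
    ∫⁻ z in ball y R, g z =
      ∫⁻ z, {w : Euc n × Euc n | dist w.2 w.1 < R}.indicator (fun w => g w.2) (y, z) := by
  rw [← lintegral_indicator measurableSet_ball]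
  rfl

theorem measurable_indicator_dist_lt {n : ℕ} {g : Euc n → ℝ≥0∞} (hg : Measurable g) (R : ℝ) :
    Measurable ({w : Euc n × Euc n | dist w.2 w.1 < R}.indicator fun w => g w.2) :=
  (hg.comp measurable_snd).indicator (isOpen_lt (by fun_prop) (by fun_prop)).measurableSet

theorem measurable_setLIntegral_ball {n : ℕ} {g : Euc n → ℝ≥0∞} (hg : Measurable g) (R : ℝ) :
    Measurable fun y => ∫⁻ z in ball y R, g z := by
  simp_rw [setLIntegral_ball_eq]
  exact (measurable_indicator_dist_lt hg R).lintegral_prod_right'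

theorem lintegral_setLIntegral_ball {n : ℕ} {g : Euc n → ℝ≥0∞} (hg : Measurable g) (R : ℝ) :
    ∫⁻ y, ∫⁻ z in ball y R, g z = volume (ball (0 : Euc n) R) * ∫⁻ z, g z := by
  simp_rw [setLIntegral_ball_eq]
  rw [lintegral_lintegral_swap (f := fun y z =>
      {w : Euc n × Euc n | dist w.2 w.1 < R}.indicator (fun w => g w.2) (y, z))
      (measurable_indicator_dist_lt hg R).aemeasurable,
    ← lintegral_const_mul _ hg]
  refine lintegral_congr fun z => ?_
  rw [← Measure.addHaar_ball_center volume z R, mul_comm, ← lintegral_indicator_const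
    measurableSet_ball]
  refine lintegral_congr fun y => ?_
  simp only [indicator, mem_ofPred_eq, mem_ball, dist_comm]

/-- A discretized Riesz potential of order one: the first `N` scales are controlled by the
`Lⁿ` norm. -/
theorem sum_scales_le {n : ℕ} {g : Euc n → ℝ≥0∞} (hg : Measurable g) {s₀ K : ℝ} (hs₀ : 0 < s₀)
    (hK : 0 < K) {s : ℕ → ℝ} (hs : ∀ i, s i = s₀ * (1 / 2) ^ i) (hn : 2 ≤ n) {p : ℝ}
    (hp : (n : ℝ).HolderConjugate p) (y : Euc n) (N : ℕ) :
    ∑ i ∈ Finset.range N, ENNReal.ofReal (s i * (s i ^ n)⁻¹) * ∫⁻ z in ball y (K * s i), g z ≤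
      (∫⁻ z, g z ^ (n : ℝ)) ^ (1 / (n : ℝ)) *
        ENNReal.ofReal ((2 ^ p * K ^ n * volume.real (ball (0 : Euc n) 1) * N) ^ (1 / p)) := by
  have hspos : ∀ i, 0 < s i := fun i => by rw [hs]; positivity
  have hsucc : ∀ i, s (i + 1) = s i / 2 := fun i => by rw [hs, hs]; ring
  have hp0 := hp.symm.pos
  have ha : ∀ i, 2 * ENNReal.ofReal (s i * (s i ^ n)⁻¹) ≤
      ENNReal.ofReal (s (i + 1) * (s (i + 1) ^ n)⁻¹) := by
    intro i
    have hsi := hspos i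
    rw [← ENNReal.ofReal_ofNat 2, ← ENNReal.ofReal_mul (by norm_num)]
    refine ENNReal.ofReal_le_ofReal ?_
    have h4 : (2 : ℝ) ^ 2 ≤ 2 ^ n := pow_le_pow_right₀ (by norm_num) hn
    have h5 : s (i + 1) * (s (i + 1) ^ n)⁻¹ = 2 ^ n / 2 * (s i * (s i ^ n)⁻¹) := by
      rw [hsucc, div_pow, inv_div]
      ring
    rw [h5]
    gcongr
    linarith
  refine (sum_mul_setLIntegral_le hg ha (B := fun i => ball y (K * s i))
    (fun i => measurableSet_ball) hp N).trans (mul_le_mul' le_rfl (le_of_eq ?_))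
  have hterm : ∀ i, ENNReal.ofReal (s i * (s i ^ n)⁻¹) ^ p * volume (ball y (K * s i)) =
      ENNReal.ofReal (K ^ n * volume.real (ball (0 : Euc n) 1)) := by
    intro i
    have hsi := hspos i
    have e1 : (s i * (s i ^ n)⁻¹) ^ p = (s i ^ n)⁻¹ := by
      have h6 : (1 - (n : ℝ)) * p = -n := by
        have := hp.mul_eq_add
        linarith
      have h7 : s i * (s i ^ n)⁻¹ = s i ^ (1 - (n : ℝ)) := by
        rw [Real.rpow_sub hsi, Real.rpow_one, Real.rpow_natCast, div_eq_mul_inv]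
      rw [h7, ← Real.rpow_mul hsi.le, h6, Real.rpow_neg hsi.le, Real.rpow_natCast]
    rw [Measure.addHaar_ball_of_pos _ _ (mul_pos hK hsi), finrank_euclideanSpace_fin,
      ENNReal.ofReal_rpow_of_pos (by positivity), e1, ← mul_assoc,
      ← ENNReal.ofReal_mul (by positivity),
      ENNReal.ofReal_mul (p := K ^ n) (by positivity),
      ofReal_measureReal measure_ball_lt_top.ne]
    congr 2
    rw [mul_pow]
    field_simp
  have h2p : (2 : ℝ≥0∞) ^ p = ENNReal.ofReal (2 ^ p) := by
    rw [← ENNReal.ofReal_rpow_of_pos two_pos, ENNReal.ofReal_ofNat]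
  simp_rw [hterm]
  rw [Finset.sum_const, Finset.card_range, nsmul_eq_mul, ← ENNReal.ofReal_natCast, h2p,
    ← ENNReal.ofReal_mul (by positivity), ← ENNReal.ofReal_mul (by positivity),
    ENNReal.ofReal_rpow_of_nonneg (by positivity) (by positivity)]
  congr 2
  ring

/-- The small scales of a discretized Riesz potential of order one are small in `L¹`. -/
theorem lintegral_tsum_scales_le {n : ℕ} {g : Euc n → ℝ≥0∞} (hg : Measurable g) {s₀ K : ℝ}
    (hs₀ : 0 < s₀) (hK : 0 < K) {s : ℕ → ℝ} (hs : ∀ i, s i = s₀ * (1 / 2) ^ i) (N : ℕ) :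
    ∫⁻ y, ∑' i, ENNReal.ofReal (s (i + N) * (s (i + N) ^ n)⁻¹) *
        ∫⁻ z in ball y (K * s (i + N)), g z =
      ENNReal.ofReal (2 * K ^ n * s₀ * (1 / 2) ^ N) * volume (ball (0 : Euc n) 1) *
        ∫⁻ z, g z := by
  have hspos : ∀ i, 0 < s i := fun i => by rw [hs]; positivity
  rw [lintegral_tsum fun i => ((measurable_setLIntegral_ball hg _).const_mul _).aemeasurable]
  have hterm : ∀ i, ∫⁻ y, ENNReal.ofReal (s (i + N) * (s (i + N) ^ n)⁻¹) *
      ∫⁻ z in ball y (K * s (i + N)), g z =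
      ENNReal.ofReal (K ^ n * s₀ * (1 / 2) ^ N * (1 / 2) ^ i) *
        (volume (ball (0 : Euc n) 1) * ∫⁻ z, g z) := by
    intro i
    have hsi := hspos (i + N)
    rw [lintegral_const_mul _ (measurable_setLIntegral_ball hg _), lintegral_setLIntegral_ball hg,
      Measure.addHaar_ball_of_pos _ _ (mul_pos hK hsi), finrank_euclideanSpace_fin, ← mul_assoc,
      ← mul_assoc, ← mul_assoc, ← ENNReal.ofReal_mul (by positivity)]
    congr 3
    have e1 : s (i + N) * (s (i + N) ^ n)⁻¹ * (K * s (i + N)) ^ n = K ^ n * s (i + N) := by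
      rw [mul_pow]
      field_simp
    rw [e1, hs]
    ring
  simp_rw [hterm]
  rw [ENNReal.tsum_mul_right, ← ENNReal.ofReal_tsum_of_nonneg (fun i => by positivity)
    ((summable_geometric_of_lt_one (by norm_num) (by norm_num)).mul_left _), _root_.tsum_mul_left,
    tsum_geometric_of_lt_one (by norm_num) (by norm_num), ← mul_assoc]
  congr 3
  norm_num
  ring

theorem lintegral_le_of_support_subset_ball {n : ℕ} {g : Euc n → ℝ≥0∞} (hg : Measurable g)
    {x : Euc n} {R : ℝ} (hR : 0 < R) (hsupp : ∀ z ∉ ball x R, g z = 0) {p : ℝ}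
    (hp : (n : ℝ).HolderConjugate p) :
    ∫⁻ z, g z ≤ (∫⁻ z, g z ^ (n : ℝ)) ^ (1 / (n : ℝ)) *
      ENNReal.ofReal (R ^ (n - 1) * volume.real (ball (0 : Euc n) 1) ^ (1 / p)) := by
  have hp0 := hp.symm.pos
  have hone : Measurable ((ball x R).indicator fun _ => (1 : ℝ≥0∞)) :=
    measurable_const.indicator measurableSet_ball
  calc ∫⁻ z, g z = ∫⁻ z, (g * (ball x R).indicator fun _ => (1 : ℝ≥0∞)) z := by
        refine lintegral_congr fun z => ?_
        by_cases hz : z ∈ ball x R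
        · simp only [Pi.mul_apply, indicator_of_mem hz, mul_one]
        · simp only [Pi.mul_apply, hsupp z hz, zero_mul]
    _ ≤ (∫⁻ z, g z ^ (n : ℝ)) ^ (1 / (n : ℝ)) *
          (∫⁻ z, (ball x R).indicator (fun _ => (1 : ℝ≥0∞)) z ^ p) ^ (1 / p) :=
        ENNReal.lintegral_mul_le_Lp_mul_Lq _ hp hg.aemeasurable hone.aemeasurable
    _ = _ := by
        have h1 : ∀ z, (ball x R).indicator (fun _ => (1 : ℝ≥0∞)) z ^ p =
            (ball x R).indicator (fun _ => 1) z := by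
          intro z
          by_cases hz : z ∈ ball x R
          · simp only [indicator_of_mem hz, ENNReal.one_rpow]
          · simp only [indicator_of_notMem hz, ENNReal.zero_rpow_of_pos hp0]
        have h2 : ((n - 1 : ℕ) : ℝ) = n * (1 / p) := by
          have hn1 : 1 ≤ n := by exact_mod_cast hp.lt.le
          have h3 := hp.mul_eq_add
          push_cast [hn1]
          field_simp
          linarith
        simp_rw [h1]
        rw [lintegral_indicator_const measurableSet_ball, one_mul,
          Measure.addHaar_ball_of_pos _ _ hR, finrank_euclideanSpace_fin,
          ← ofReal_measureReal (measure_ball_lt_top (x := (0 : Euc n)) (r := 1)).ne,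
          ← ENNReal.ofReal_mul (by positivity),
          ENNReal.ofReal_rpow_of_nonneg (by positivity) (by positivity),
          Real.mul_rpow (by positivity) measureReal_nonneg, ← Real.rpow_natCast R (n - 1), h2,
          Real.rpow_mul hR.le, Real.rpow_natCast]

theorem IsUniformWith.abs_sub_le {n : ℕ} {u : Euc n → ℝ} {Ω : Set (Euc n)} (hΩ : IsOpen Ω)
    (hu : LocallyLipschitzOn Ω u) {ε₀ : ℝ} (hU : IsUniformWith Ω ε₀) (hε₀ : 0 < ε₀)
    (hε₁ : ε₀ ≤ 1) {x : Euc n} (hx : x ∈ Ω) {r : ℝ} (hr : 0 < r) (hrd : r < diam Ω) {s : ℕ → ℝ}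
    (hs : ∀ i, s i = r / 4 * (1 / 2) ^ i) :
    ∃ c : ℝ, ∀ y ∈ ball x r ∩ Ω, ENNReal.ofReal (volume.real (ball (0 : Euc n) 1) * |u y - c|) ≤
      ENNReal.ofReal (3 * (6 / ε₀ * (128 / ε₀ ^ 2) ^ n)) *
        ∑' i : ℕ, ENNReal.ofReal (s i * (s i ^ n)⁻¹) * ∫⁻ z in ball y (8 / ε₀ * s i),
          (ball x (3 / ε₀ * r) ∩ Ω).indicator (fun z => ‖fderiv ℝ u z‖ₑ) z := by
  obtain ⟨z₀, hz₀, hxz, hzd⟩ := hU.exists_corkscrew hε₀ hrd hx (s := r / 4) (by positivity) le_rfl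
  set ω := volume.real (ball (0 : Euc n) 1) with hω
  have hω0 : 0 < ω := ENNReal.toReal_pos (measure_ball_pos _ _ one_pos).ne' measure_ball_lt_top.ne
  refine ⟨ballIntegral u z₀ (ε₀ ^ 2 / 64 * (r / 4)) / ω, fun y hy => ?_⟩
  have hyx : dist y x < r := hy.1
  have hr4 : 0 < r / 4 := by positivity
  have hεr : r ≤ r / ε₀ := by
    rw [le_div_iff₀ hε₀]
    nlinarith
  have h1 := edist_ballIntegral_le_tsum hΩ hu hU hε₀ hε₁ hr4 hs (by linarith) hy.2 hz₀
    (by linarith [dist_triangle y x z₀]) (by nlinarith [mul_pos hε₀ hr4])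
  rw [edist_comm, edist_dist, Real.dist_eq, ← hω] at h1
  have h2 : ω * |u y - ballIntegral u z₀ (ε₀ ^ 2 / 64 * (r / 4)) / ω| =
      |ω * u y - ballIntegral u z₀ (ε₀ ^ 2 / 64 * (r / 4))| := by
    rw [← abs_of_pos hω0, ← abs_mul, abs_of_pos hω0]
    congr 1
    field_simp
  rw [h2]
  refine h1.trans (mul_le_mul' le_rfl (ENNReal.tsum_le_tsum fun i => mul_le_mul' le_rfl ?_))
  rw [setLIntegral_indicator (isOpen_ball.inter hΩ).measurableSet]
  refine lintegral_mono_set fun z hz => ⟨⟨?_, hz.2⟩, hz.1⟩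
  refine ball_subset_ball' ?_ hz.1
  have h3 : s i ≤ r / 4 := (hs i).trans_le <|
    mul_le_of_le_one_right hr4.le (pow_le_one₀ (by norm_num) (by norm_num))
  have h4 : 8 / ε₀ * s i ≤ 8 / ε₀ * (r / 4) := by gcongr
  have h5 : 8 / ε₀ * (r / 4) = 2 * (r / ε₀) := by ring
  have h6 : 3 / ε₀ * r = 3 * (r / ε₀) := by ring
  linarith

/-- Exponential integrability of a function dominated by a discretized Riesz potential of order
one of a function in `Lⁿ`. -/
theorem lintegral_exp_le_of_le_tsum_scales {n : ℕ} (hn : 2 ≤ n) {g : Euc n → ℝ≥0∞}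
    (hg : Measurable g) {x : Euc n} {r K lam : ℝ} (hr : 0 < r) (hK : 0 < K) (hlam : 0 < lam)
    (hsupp : ∀ z ∉ ball x (lam * r), g z = 0) {p : ℝ} (hp : (n : ℝ).HolderConjugate p)
    {s : ℕ → ℝ} (hs : ∀ i, s i = r / 4 * (1 / 2) ^ i)
    (hI0 : ∫⁻ z, g z ^ (n : ℝ) ≠ 0) (hI : ∫⁻ z, g z ^ (n : ℝ) ≠ ⊤)
    {S : Set (Euc n)} (hS : MeasurableSet S) (hSr : S ⊆ ball x r) {f : Euc n → ℝ} {D : ℝ}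
    (hD : 0 < D) (hf0 : ∀ y, 0 ≤ f y)
    (hf : ∀ y ∈ S, ENNReal.ofReal (f y) ≤ ENNReal.ofReal D *
      ∑' i : ℕ, ENNReal.ofReal (s i * (s i ^ n)⁻¹) * ∫⁻ z in ball y (K * s i), g z) :
    ∫⁻ y in S, ENNReal.ofReal (Real.exp ((
        1 / (4 * D * (2 ^ p * K ^ n * volume.real (ball (0 : Euc n) 1) + 1) ^ (1 / p)) * f y /
          (∫⁻ z, g z ^ (n : ℝ)).toReal ^ (1 / (n : ℝ))) ^ p)) ≤
      ENNReal.ofReal (Real.exp (1 / 2) +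
        K ^ n * lam ^ (n - 1) / 2 * volume.real (ball (0 : Euc n) 1) ^ (1 / p) * Real.exp 1 /
          (1 - Real.exp (1 / 2) / 2)) * volume (ball x r) := by
  set ω := volume.real (ball (0 : Euc n) 1) with hω
  have hω0 : 0 ≤ ω := measureReal_nonneg
  set I := ∫⁻ z, g z ^ (n : ℝ) with hIdef
  have hp0 := hp.symm.pos
  set M := 2 ^ p * K ^ n * ω with hM
  have hM0 : 0 ≤ M := by positivity
  set G := I.toReal ^ (1 / (n : ℝ)) with hG
  have hG0 : 0 < G := Real.rpow_pos_of_pos (ENNReal.toReal_pos hI0 hI) _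
  have hIG : I ^ (1 / (n : ℝ)) = ENNReal.ofReal G := by
    rw [hG, ← ENNReal.ofReal_rpow_of_pos (ENNReal.toReal_pos hI0 hI), ENNReal.ofReal_toReal hI]
  set a : ℕ → Euc n → ℝ≥0∞ := fun i y =>
    ENNReal.ofReal (s i * (s i ^ n)⁻¹) * ∫⁻ z in ball y (K * s i), g z with ha
  have ham : ∀ i, Measurable (a i) := fun i => (measurable_setLIntegral_ball hg _).const_mul _
  set T : ℕ → Euc n → ℝ≥0∞ := fun N y => ∑' i, a (i + N) y with hT
  have hTm : ∀ N, Measurable (T N) := fun N => Measurable.tsum fun i => ham _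
  have hr4 : 0 < r / 4 := by positivity
  refine lintegral_exp_le_of_superlevel hS (E := fun N => {y | I ^ (1 / (n : ℝ)) ≤ T N y})
    (fun N => measurableSet_le measurable_const (hTm N)) (by positivity) (fun N y hy hyE => ?_)
    (fun N => ?_) (measure_mono hSr)
  · have hyT : T N y ≤ ENNReal.ofReal G := by
      rw [← hIG]
      exact (not_le.1 hyE).le
    have h1 := sum_scales_le hg hr4 hK hs hn hp y N
    rw [← hIdef, hIG] at h1
    have hsplit : ∑' i, a i y = ∑ i ∈ Finset.range N, a i y + T N y :=
      (Summable.sum_add_tsum_nat_add' (f := fun i => a i y) ENNReal.summable).symm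
    have h2 := (hf y hy).trans_eq (congrArg _ hsplit)
    have h3 : ENNReal.ofReal (f y) ≤ ENNReal.ofReal (D * (G * (M * N) ^ (1 / p) + G)) := by
      refine h2.trans ?_
      rw [ENNReal.ofReal_mul hD.le, ENNReal.ofReal_add (by positivity) hG0.le,
        ENNReal.ofReal_mul hG0.le]
      exact mul_le_mul' le_rfl (add_le_add h1 hyT)
    have h4 := (ENNReal.ofReal_le_ofReal_iff (by positivity)).1 h3
    have h5 : (M * N) ^ (1 / p) ≤ (M + 1) ^ (1 / p) * (N + 1 : ℝ) ^ (1 / p) := by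
      rw [← Real.mul_rpow (by positivity) (by positivity)]
      gcongr <;> linarith
    have h6 : 1 ≤ (M + 1) ^ (1 / p) * (N + 1 : ℝ) ^ (1 / p) := by
      rw [← Real.mul_rpow (by positivity) (by positivity)]
      refine Real.one_le_rpow ?_ (by positivity)
      nlinarith [mul_nonneg hM0 (Nat.cast_nonneg (α := ℝ) N), Nat.cast_nonneg (α := ℝ) N]
    have hM1 : 0 < (M + 1) ^ (1 / p) := by positivity
    have h7 : 1 / (4 * D * (M + 1) ^ (1 / p)) * f y / G ≤ 1 / 2 * (N + 1 : ℝ) ^ (1 / p) := by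
      rw [div_le_iff₀ hG0, one_div, inv_mul_le_iff₀ (by positivity)]
      refine h4.trans ?_
      have h8 : G * (M * N) ^ (1 / p) + G ≤
          G * (2 * ((M + 1) ^ (1 / p) * (N + 1 : ℝ) ^ (1 / p))) := by nlinarith
      calc D * (G * (M * N) ^ (1 / p) + G)
          ≤ D * (G * (2 * ((M + 1) ^ (1 / p) * (N + 1 : ℝ) ^ (1 / p)))) := by gcongr
        _ = _ := by ring
    have h9 := hf0 y
    calc (1 / (4 * D * (M + 1) ^ (1 / p)) * f y / G) ^ p
        ≤ (1 / 2 * (N + 1 : ℝ) ^ (1 / p)) ^ p := by gcongr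
      _ = (1 / 2) ^ p * (N + 1) := by
          rw [Real.mul_rpow (by positivity) (by positivity), ← Real.rpow_mul (by positivity),
            one_div_mul_cancel hp0.ne', Real.rpow_one]
      _ ≤ (1 / 2) ^ (1 : ℝ) * (N + 1) := by
          refine mul_le_mul_of_nonneg_right ?_ (by positivity)
          exact Real.rpow_le_rpow_of_exponent_ge (by norm_num) (by norm_num) hp.symm.lt.le
      _ = (N + 1) / 2 := by
          rw [Real.rpow_one]
          ring
  · have hIpos : I ^ (1 / (n : ℝ)) ≠ 0 := by
      rw [hIG]
      exact (ENNReal.ofReal_pos.2 hG0).ne'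
    have hItop : I ^ (1 / (n : ℝ)) ≠ ⊤ := by
      rw [hIG]
      exact ENNReal.ofReal_ne_top
    refine (meas_ge_le_lintegral_div (hTm N).aemeasurable hIpos hItop).trans ?_
    rw [ENNReal.div_le_iff_le_mul (Or.inl hIpos) (Or.inl hItop)]
    refine (lintegral_tsum_scales_le hg hr4 hK hs N).trans_le ?_
    refine (mul_le_mul' le_rfl
      (lintegral_le_of_support_subset_ball hg (mul_pos hlam hr) hsupp hp)).trans_eq ?_
    rw [← hIdef, Measure.addHaar_ball_of_pos _ x hr, finrank_euclideanSpace_fin, ← hω]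
    have h1 : ENNReal.ofReal (2 * K ^ n * (r / 4) * (1 / 2) ^ N) *
        ENNReal.ofReal ((lam * r) ^ (n - 1) * ω ^ (1 / p)) =
        ENNReal.ofReal (K ^ n * lam ^ (n - 1) / 2 * ω ^ (1 / p) * (1 / 2) ^ N) *
          ENNReal.ofReal (r ^ n) := by
      rw [← ENNReal.ofReal_mul (by positivity), ← ENNReal.ofReal_mul (by positivity)]
      congr 1
      obtain ⟨m, rfl⟩ : ∃ m, n = m + 1 := ⟨n - 1, by omega⟩
      rw [Nat.add_sub_cancel, mul_pow, pow_succ r m]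
      ring
    calc _ = ENNReal.ofReal (2 * K ^ n * (r / 4) * (1 / 2) ^ N) *
          ENNReal.ofReal ((lam * r) ^ (n - 1) * ω ^ (1 / p)) *
          (volume (ball (0 : Euc n) 1) * I ^ (1 / (n : ℝ))) := by ring
      _ = _ := by
          rw [h1]
          ring

/-- a bounded uniform domain is a local Sobolev–Poincaré imbedding
domain of order `n` (local Trudinger inequality). -/
theorem stmt1 (n : ℕ) (hn : 2 ≤ n)
    (Ω : Set (Euc n)) (hOpen : IsOpen Ω)
    (hConn : IsConnected Ω) (hBdd : Bornology.IsBounded Ω)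
    (hUnif : IsUniformDomain Ω) :
    LocalSPn n Ω := by
  obtain ⟨ε₀, hε₀, hε₁, hU⟩ := hUnif
  have hn1 : (1 : ℝ) < n := by exact_mod_cast hn
  have hp : (n : ℝ).HolderConjugate (n / (n - 1)) := Real.HolderConjugate.conjExponent hn1
  set p : ℝ := n / (n - 1) with hpdef
  set ω := volume.real (ball (0 : Euc n) 1) with hω
  have hω0 : 0 < ω := ENNReal.toReal_pos (measure_ball_pos _ _ one_pos).ne' measure_ball_lt_top.ne
  set D : ℝ := 3 * (6 / ε₀ * (128 / ε₀ ^ 2) ^ n) with hD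
  have hD0 : 0 < D := by positivity
  set A₀ : ℝ := 1 / (4 * D * (2 ^ p * (8 / ε₀) ^ n * ω + 1) ^ (1 / p)) with hA₀
  have hA₀0 : 0 < A₀ := by positivity
  have hexp := exp_half_div_two_lt_one
  refine ⟨Real.exp (1 / 2) + (8 / ε₀) ^ n * (3 / ε₀) ^ (n - 1) / 2 * ω ^ (1 / p) * Real.exp 1 /
    (1 - Real.exp (1 / 2) / 2), ?_, 3 / ε₀, ?_, A₀ * ω, by positivity, ?_⟩
  · have h1 : 1 ≤ Real.exp (1 / 2) := Real.one_le_exp (by norm_num)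
    exact h1.trans (le_add_of_nonneg_right (div_nonneg (by positivity) (by linarith)))
  · rw [le_div_iff₀ hε₀]
    linarith
  intro u hu x hx r hr hrd hI0 hI
  obtain ⟨c, hc⟩ := hU.abs_sub_le hOpen hu hε₀ hε₁ hx hr hrd (s := fun i => r / 4 * (1 / 2) ^ i)
    fun i => rfl
  set W := ball x (3 / ε₀ * r) ∩ Ω with hW
  have hWm : MeasurableSet W := (isOpen_ball.inter hOpen).measurableSet
  have hg : Measurable (W.indicator fun z => ‖fderiv ℝ u z‖ₑ) :=
    (measurable_fderiv ℝ u).enorm.indicator hWm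
  have hIeq : ∫⁻ z in W, ENNReal.ofReal ‖fderiv ℝ u z‖ ^ (n : ℝ) =
      ∫⁻ z, W.indicator (fun z => ‖fderiv ℝ u z‖ₑ) z ^ (n : ℝ) := by
    rw [← lintegral_indicator hWm]
    refine lintegral_congr fun z => ?_
    by_cases hz : z ∈ W
    · simp only [indicator_of_mem hz, ofReal_norm]
    · simp only [indicator_of_notMem hz, ENNReal.zero_rpow_of_pos (zero_lt_one.trans hn1)]
  rw [hIeq] at hI0 hI ⊢
  refine (iInf_le _ c).trans ?_
  have hmain := lintegral_exp_le_of_le_tsum_scales hn hg hr (K := 8 / ε₀) (lam := 3 / ε₀)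
    (by positivity) (by positivity)
    (fun z hz => indicator_of_notMem (fun h => hz h.1) _) hp (fun i => rfl) hI0.ne' hI.ne
    (measurableSet_ball.inter hOpen.measurableSet) inter_subset_left
    (f := fun y => ω * |u y - c|) hD0 (fun y => by positivity) hc
  simp_rw [mul_assoc A₀]
  exact hmain
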